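/- arXiv:2504.19689 — 6 statements merged into one kernel-verified Lean document; each statement's English description precedes it below -/
import Mathlib

section
/- The m^d matrices γ^j, as j ranges over all multi-indices in {0,…,m−1}^d, form a basis of the ℂ-vector space Mat(m^{d/2},ℂ); in particular they are linearly independent over ℂ. (This is the content of the isomorphism between the generalized Clifford algebra Cl^{1/m}_d with even d and the full matrix algebra Mat(m^{d/2},ℂ).) -/
open Matrix

lemma addChar_map_sum {A M ι : Type*} [AddCommMonoid A] [CommMonoid M] (χ : AddChar A M)
    (s : Finset ι) (f : ι → A) : χ (∑ i ∈ s, f i) = ∏ i ∈ s, χ (f i) :=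
  map_prod χ.toMonoidHom (fun i => Multiplicative.ofAdd (f i)) s

section DotChar

variable {R ι : Type*} [CommRing R] [Fintype ι]

/-- The character `w ↦ χ (y ⬝ᵥ w)`. -/
def dotChar (χ : AddChar R ℂ) (y : ι → R) : AddChar (ι → R) ℂ where
  toFun w := χ (y ⬝ᵥ w)
  map_zero_eq_one' := by simp
  map_add_eq_mul' v w := by rw [dotProduct_add, AddChar.map_add_eq_mul]

lemma dotChar_injective [DecidableEq ι] {χ : AddChar R ℂ} (hχ : χ.IsPrimitive) :
    Function.Injective (dotChar (ι := ι) χ) := by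
  intro y z hyz
  funext t
  refine AddChar.to_mulShift_inj_of_isPrimitive hχ (DFunLike.ext _ _ fun r => ?_)
  simpa [dotChar] using DFunLike.congr_fun hyz (Pi.single t r)

end DotChar

section Weyl

variable {R ι : Type*} [CommRing R] [DecidableEq R] [Fintype ι]

/-- The Weyl operator of phase-space type `p = (x, y)`: the shift by `x` followed by
multiplication with the character `w ↦ χ (y ⬝ᵥ w)`. -/
def weylMatrix (χ : AddChar R ℂ) (p : (ι → R) × (ι → R)) : Matrix (ι → R) (ι → R) ℂ :=
  Matrix.of fun v w => if w = v + p.1 then χ (p.2 ⬝ᵥ w) else 0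

/-- `M` is a nonzero multiple of the Weyl operator of type `p`. -/
def IsWeylMultiple (χ : AddChar R ℂ) (M : Matrix (ι → R) (ι → R) ℂ)
    (p : (ι → R) × (ι → R)) : Prop :=
  ∃ c : ℂ, c ≠ 0 ∧ M = c • weylMatrix χ p

lemma weylMatrix_zero (χ : AddChar R ℂ) : weylMatrix χ (0 : (ι → R) × (ι → R)) = 1 := by
  ext v w
  simp [weylMatrix, Matrix.one_apply, eq_comm]

lemma IsWeylMultiple.one (χ : AddChar R ℂ) :
    IsWeylMultiple χ (1 : Matrix (ι → R) (ι → R) ℂ) 0 :=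
  ⟨1, one_ne_zero, by rw [weylMatrix_zero, one_smul]⟩

/-- A tensor product of nonzero multiples of one-site Weyl operators. -/
lemma IsWeylMultiple.of_prod {χ : AddChar R ℂ} {M : Matrix (ι → R) (ι → R) ℂ}
    (A : ι → Matrix R R ℂ) (hM : ∀ v w, M v w = ∏ t, A t (v t) (w t))
    (p : (ι → R) × (ι → R)) (c : ι → ℂ) (hc : ∀ t, c t ≠ 0)
    (hA : ∀ t r s, A t r s = c t * if s = r + p.1 t then χ (p.2 t * s) else 0) :
    IsWeylMultiple χ M p := by
  refine ⟨∏ t, c t, Finset.prod_ne_zero_iff.2 fun t _ => hc t, ?_⟩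
  ext v w
  simp only [hM, hA, weylMatrix, Matrix.smul_apply, Matrix.of_apply, smul_eq_mul,
    Finset.prod_mul_distrib, Finset.prod_ite_zero, Finset.mem_univ, true_imp_iff, dotProduct,
    addChar_map_sum, funext_iff, Pi.add_apply]

variable [Fintype R] [DecidableEq ι]

lemma weylMatrix_mul (χ : AddChar R ℂ) (p q : (ι → R) × (ι → R)) :
    weylMatrix χ p * weylMatrix χ q = χ (-(p.2 ⬝ᵥ q.1)) • weylMatrix χ (p + q) := by
  ext v w
  simp only [weylMatrix, Matrix.mul_apply, Matrix.of_apply, Matrix.smul_apply, ite_mul, zero_mul,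
    Finset.sum_ite_eq', Finset.mem_univ, if_true, Prod.fst_add, Prod.snd_add,
    smul_eq_mul, ← add_assoc]
  split_ifs with h
  · subst h
    rw [← AddChar.map_add_eq_mul, ← AddChar.map_add_eq_mul]
    congr 1
    simp only [dotProduct_add, add_dotProduct]
    ring
  · simp

lemma IsWeylMultiple.mul {χ : AddChar R ℂ} {M N : Matrix (ι → R) (ι → R) ℂ}
    {p q : (ι → R) × (ι → R)} (hM : IsWeylMultiple χ M p) (hN : IsWeylMultiple χ N q) :
    IsWeylMultiple χ (M * N) (p + q) := by
  obtain ⟨c, hc, rfl⟩ := hM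
  obtain ⟨d, hd, rfl⟩ := hN
  refine ⟨c * d * χ (-(p.2 ⬝ᵥ q.1)), mul_ne_zero (mul_ne_zero hc hd) (χ.val_isUnit _).ne_zero, ?_⟩
  rw [smul_mul_smul_comm, weylMatrix_mul, smul_smul]

lemma IsWeylMultiple.pow {χ : AddChar R ℂ} {M : Matrix (ι → R) (ι → R) ℂ}
    {p : (ι → R) × (ι → R)} (hM : IsWeylMultiple χ M p) (n : ℕ) :
    IsWeylMultiple χ (M ^ n) (n • p) := by
  induction n with
  | zero => simpa using IsWeylMultiple.one χ
  | succ n ih => simpa only [pow_succ, succ_nsmul] using ih.mul hM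

lemma IsWeylMultiple.list_prod {χ : AddChar R ℂ} {κ : Type*}
    {M : κ → Matrix (ι → R) (ι → R) ℂ} {p : κ → (ι → R) × (ι → R)}
    (hM : ∀ a, IsWeylMultiple χ (M a) (p a)) (l : List κ) :
    IsWeylMultiple χ (l.map M).prod (l.map p).sum := by
  induction l with
  | nil => exact IsWeylMultiple.one χ
  | cons a l ih => simpa using (hM a).mul ih

lemma linearIndependent_weylMatrix {χ : AddChar R ℂ} (hχ : χ.IsPrimitive) :
    LinearIndependent ℂ (weylMatrix (ι := ι) χ) := by
  rw [Fintype.linearIndependent_iff]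
  rintro g hg ⟨x, y⟩
  have hli := (AddChar.linearIndependent (ι → R) ℂ).comp _ (dotChar_injective (ι := ι) hχ)
  rw [Fintype.linearIndependent_iff] at hli
  refine hli (fun y => g (x, y)) (funext fun w => ?_) y
  have hw := congr_fun (congr_fun hg (w - x)) w
  simpa [Matrix.sum_apply, weylMatrix, Fintype.sum_prod_type, dotChar, sub_add_eq_add_sub,
    eq_sub_iff_add_eq, Finset.sum_ite_irrel] using hw

lemma linearIndependent_of_isWeylMultiple {χ : AddChar R ℂ} (hχ : χ.IsPrimitive) {κ : Type*}
    {M : κ → Matrix (ι → R) (ι → R) ℂ} {p : κ → (ι → R) × (ι → R)}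
    (hp : Function.Injective p) (hM : ∀ a, IsWeylMultiple χ (M a) (p a)) :
    LinearIndependent ℂ M := by
  choose c hc hcM using hM
  have := ((linearIndependent_weylMatrix hχ).comp p hp).units_smul fun a => Units.mk0 (c a) (hc a)
  convert this using 1
  exact funext hcM

end Weyl

/-- The type of the generator `γ_a` (indexed from `0`) as a Weyl operator. -/
def cliffordType (R : Type*) [CommRing R] {h : ℕ} (a : Fin (2 * h)) :
    (Fin h → R) × (Fin h → R) :=
  (fun t => if (t : ℕ) = (a : ℕ) / 2 then 1 else 0, fun t => if 2 * (t : ℕ) + 1 ≤ a then 1 else 0)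

lemma linearIndependent_cliffordType (R : Type*) [CommRing R] (h : ℕ) :
    LinearIndependent R (cliffordType R (h := h)) := by
  rw [Fintype.linearIndependent_iff]
  intro j hj
  set S : ℕ → R := fun k => ∑ a : Fin (2 * h), if k ≤ (a : ℕ) then j a else 0 with hS
  have hstep (a : Fin (2 * h)) : S a = j a + S (a + 1) := by
    have hja : j a = ∑ b, if b = a then j b else 0 := by simp
    rw [hja, hS, ← Finset.sum_add_distrib]
    refine Finset.sum_congr rfl fun b _ => ?_
    simp only [Fin.ext_iff]
    split_ifs <;> first | omega | simp
  have hodd (t : Fin h) : S (2 * t + 1) = 0 := by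
    simpa [hS, cliffordType, Prod.snd_sum, Nat.succ_le_iff] using congr_fun (congr_arg Prod.snd hj) t
  have hpair (t : Fin h) : S (2 * t) = S (2 * (t + 1)) := by
    have hx : ∑ a : Fin (2 * h), (if (t : ℕ) = (a : ℕ) / 2 then j a else 0) = 0 := by
      simpa [cliffordType, Prod.fst_sum] using congr_fun (congr_arg Prod.fst hj) t
    rw [← sub_eq_zero, ← hx, hS, ← Finset.sum_sub_distrib]
    refine Finset.sum_congr rfl fun a _ => ?_
    split_ifs <;> first | omega | simp
  have heven (n : ℕ) (hn : n ≤ h) : S (2 * n) = 0 := by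
    induction hn using Nat.decreasingInduction with
    | self => exact Finset.sum_eq_zero fun a _ => if_neg (by omega)
    | of_succ n hn ih => exact (hpair ⟨n, hn⟩).trans ih
  have hzero (n : ℕ) (hn : n ≤ 2 * h) : S n = 0 := by
    obtain ⟨k, rfl | rfl⟩ := Nat.even_or_odd' n
    · exact heven k (by omega)
    · exact hodd ⟨k, by omega⟩
  intro a
  simpa [hzero a a.2.le, hzero (a + 1) a.2] using (hstep a).symm

theorem generalizedClifford_basis_of_matrixAlgebra (m h : ℕ) (hm : 2 ≤ m) (hh : 1 ≤ h)
    (ω : ℂ) (hω : ω = Complex.exp (2 * Real.pi * Complex.I / m))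
    (ζ : ℂ) (hζ : ζ = Complex.exp (Real.pi * Complex.I / m))
    (P R Q : Matrix (Fin m) (Fin m) ℂ)
    (hP : ∀ j k : Fin m, P j k = if (k : ℕ) = ((j : ℕ) + 1) % m then 1 else 0)
    (hR : R = Matrix.diagonal (fun j : Fin m => ω ^ (j : ℕ)))
    (hQ : Q = if Odd m then P * R else ζ • (P * R))
    (γ : Fin (2 * h) → Matrix (Fin h → Fin m) (Fin h → Fin m) ℂ)
    (hγ : ∀ (a : Fin (2 * h)) (v w : Fin h → Fin m),
      γ a v w = ∏ t : Fin h,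
        (if (t : ℕ) < (a : ℕ) / 2 then R
         else if (t : ℕ) = (a : ℕ) / 2 then (if (a : ℕ) % 2 = 0 then P else Q)
         else 1) (v t) (w t))
    (Γ : (Fin (2 * h) → Fin m) → Matrix (Fin h → Fin m) (Fin h → Fin m) ℂ)
    (hΓ : ∀ j, Γ j = ((List.finRange (2 * h)).map (fun a => γ a ^ ((j a : ℕ)))).prod) :
    LinearIndependent ℂ Γ ∧
    Submodule.span ℂ (Set.range Γ) = ⊤ := by
  obtain ⟨n, rfl⟩ : ∃ n, m = n + 1 := ⟨m - 1, by omega⟩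
  set χ : AddChar (ZMod (n + 1)) ℂ := ZMod.stdAddChar
  have hχ (s : ZMod (n + 1)) : χ s = ω ^ s.val := by
    have := ZMod.stdAddChar_coe (N := n + 1) (s.val : ℤ)
    rw [Int.cast_natCast, ZMod.natCast_zmod_val] at this
    rw [this, hω, ← Complex.exp_nat_mul]
    congr 1
    push_cast
    ring
  have hP' (r s : ZMod (n + 1)) : P r s = if s = r + 1 then 1 else 0 := by
    refine (hP r s).trans (if_congr ?_ rfl rfl)
    rw [← (ZMod.val_injective (n + 1)).eq_iff, ZMod.val_add, ZMod.val_one'' (by omega)]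
    rfl
  have hR' (r s : ZMod (n + 1)) : R r s = if s = r then χ s else 0 := by
    rw [hR, hχ]
    by_cases hrs : s = r
    · subst hrs; exact (Matrix.diagonal_apply_eq _ _).trans (if_pos rfl).symm
    · exact (Matrix.diagonal_apply_ne _ (Ne.symm hrs)).trans (if_neg hrs).symm
  obtain ⟨q, hq, hQ'⟩ : ∃ q : ℂ, q ≠ 0 ∧
      ∀ r s : ZMod (n + 1), Q r s = q * if s = r + 1 then χ s else 0 := by
    have hPR (r s : ZMod (n + 1)) : (P * R) r s = if s = r + 1 then χ s else 0 := by
      rw [hR]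
      refine (Matrix.mul_diagonal _ _ _ _).trans ?_
      rw [hP', ite_mul, one_mul, zero_mul, hχ]
      rfl
    refine ⟨if Odd (n + 1) then 1 else ζ, ?_, fun r s => ?_⟩
    · split_ifs
      · exact one_ne_zero
      · exact hζ ▸ Complex.exp_ne_zero _
    · rw [hQ, ← hPR]
      split_ifs
      exacts [(one_mul _).symm, rfl]
  have hγ' (a : Fin (2 * h)) : IsWeylMultiple (R := ZMod (n + 1)) χ (γ a) (cliffordType (ZMod (n + 1)) a) := by
    refine IsWeylMultiple.of_prod (R := ZMod (n + 1)) _ (hγ a) _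
      (fun t => if (t : ℕ) = (a : ℕ) / 2 ∧ (a : ℕ) % 2 ≠ 0 then q else 1)
      (fun t => by split_ifs <;> simp [hq]) fun t r s => ?_
    rcases lt_trichotomy (t : ℕ) ((a : ℕ) / 2) with ht | ht | ht
    · have h1 : 2 * (t : ℕ) + 1 ≤ a := by omega
      simp only [cliffordType, if_pos ht, if_pos h1, ht.ne, false_and, if_false,
        add_zero, one_mul]
      exact hR' r s
    · rcases Nat.mod_two_eq_zero_or_one a with ha | ha
      · have h1 : ¬ 2 * (t : ℕ) + 1 ≤ a := by omega
        simp only [cliffordType, if_neg ht.not_lt, if_pos ht, if_neg h1, ha, ne_eq, not_true,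
          and_false, if_false, if_true, zero_mul, one_mul, AddChar.map_zero_eq_one]
        exact hP' r s
      · have h1 : 2 * (t : ℕ) + 1 ≤ a := by omega
        simp only [cliffordType, if_neg ht.not_lt, if_pos ht, if_pos h1, ha, ne_eq, one_ne_zero,
          not_false_eq_true, and_true, if_false, one_mul]
        exact hQ' r s
    · have h1 : ¬ 2 * (t : ℕ) + 1 ≤ a := by omega
      simp only [cliffordType, if_neg ht.not_gt, if_neg h1, ht.ne', false_and,
        if_false, add_zero, zero_mul, one_mul, AddChar.map_zero_eq_one]
      exact (Matrix.one_apply (i := r) (j := s)).trans (if_congr eq_comm rfl rfl)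
  have hΓ' (j : Fin (2 * h) → ZMod (n + 1)) :
      IsWeylMultiple χ (Γ j) (∑ a, j a • cliffordType (ZMod (n + 1)) a) := by
    have := IsWeylMultiple.list_prod (fun a => (hγ' a).pow (j a).val) (List.finRange (2 * h))
    refine (congrArg₂ (IsWeylMultiple χ) (hΓ j) ?_).mpr this
    rw [← List.ofFn_eq_map, List.sum_ofFn]
    refine Finset.sum_congr rfl fun a _ => ?_
    rw [← Nat.cast_smul_eq_nsmul (ZMod (n + 1)), ZMod.natCast_zmod_val]
  have hli : LinearIndependent ℂ Γ := by
    refine linearIndependent_of_isWeylMultiple (R := ZMod (n + 1))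
      (ZMod.isPrimitive_stdAddChar (n + 1)) ?_ hΓ'
    exact (linearIndependent_cliffordType (ZMod (n + 1)) h).fintypeLinearCombination_injective
  refine ⟨hli, hli.span_eq_top_of_card_eq_finrank' ?_⟩
  simp [Module.finrank_matrix, two_mul, pow_add]
end

section
/- For every A ∈ Mat(n,ℂ), the characteristic polynomial of A satisfies charpoly(A) = X^n − Σ_{k=1}^{n} c_k·X^{n−k}, where c_1,…,c_n are produced by the Faddeev–LeVerrier recursion. -/
open Matrix Polynomial

/-- The Faddeev–LeVerrier sequence: `flM A k` is the matrix `M_k` for `k ≥ 1`,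
defined by `M_1 = A` and `M_{k+1} = A * (M_k - c_k • 1)` where `c_k = tr(M_k) / k`.
(With the convention `flM A 0 = 1`; since division by `0` gives `0` in `ℂ`,
this yields `flM A 1 = A`.) -/
noncomputable def flM {n : ℕ} (A : Matrix (Fin n) (Fin n) ℂ) : ℕ → Matrix (Fin n) (Fin n) ℂ
  | 0 => 1
  | k + 1 => A * (flM A k - ((Matrix.trace (flM A k)) / (k : ℂ)) • (1 : Matrix (Fin n) (Fin n) ℂ))

/-- The Faddeev–LeVerrier coefficient `c_k = tr(M_k) / k`. -/
noncomputable def flC {n : ℕ} (A : Matrix (Fin n) (Fin n) ℂ) (k : ℕ) : ℂ :=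
  Matrix.trace (flM A k) / (k : ℂ)

/-- The determinant of a polynomial in `A` is the product of its values at the eigenvalues. -/
theorem Matrix.det_aeval_eq_prod_roots_charpoly {ι K : Type*} [Fintype ι] [DecidableEq ι]
    [Field K] [IsAlgClosed K] (A : Matrix ι ι K) (p : K[X]) :
    (aeval A p).det = (A.charpoly.roots.map fun x ↦ p.eval x).prod := by
  have hcard : A.charpoly.roots.card = Fintype.card ι := by
    rw [← (IsAlgClosed.splits A.charpoly).natDegree_eq_card_roots, A.charpoly_natDegree_eq_dim]
  induction IsAlgClosed.splits p using Submonoid.closure_induction with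
  | mem q hq =>
    obtain ⟨c, rfl⟩ | ⟨c, rfl⟩ := hq
    · simp [Matrix.algebraMap_eq_diagonal, hcard]
    · have h := A.eval_charpoly (-c)
      rw [(IsAlgClosed.splits A.charpoly).eval_eq_prod_roots_of_monic A.charpoly_monic] at h
      have hA : aeval A (X + C c) = -(Matrix.scalar ι (-c) - A) := by
        rw [map_neg, map_add, aeval_X, aeval_C, neg_sub, sub_neg_eq_add]
        rfl
      rw [hA, Matrix.det_neg, ← h, ← hcard, ← Multiset.card_map (fun x ↦ -c - x),
        ← Multiset.prod_map_neg, Multiset.map_map]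
      simp [add_comm]
  | one => simp
  | mul q r _ _ hq hr => simp [hq, hr, Multiset.prod_map_mul]

/-- The trace of `A ^ k` is the sum of the `k`-th powers of the eigenvalues. -/
theorem Matrix.trace_pow_eq_sum_roots_charpoly {ι K : Type*} [Fintype ι] [DecidableEq ι]
    [Field K] [IsAlgClosed K] (A : Matrix ι ι K) (k : ℕ) :
    (A ^ k).trace = (A.charpoly.roots.map (· ^ k)).sum := by
  have h : (A ^ k).charpoly = ((A.charpoly.roots.map (· ^ k)).map fun x ↦ X - C x).prod := by
    have := IsAlgClosed.instInfinite (K := K)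
    refine Polynomial.funext fun y ↦ ?_
    have hy := A.det_aeval_eq_prod_roots_charpoly (C y - X ^ k)
    rw [Matrix.eval_charpoly, Polynomial.eval_multiset_prod]
    simpa [Matrix.algebraMap_eq_diagonal, Matrix.scalar_apply, Pi.algebraMap_def,
      Function.comp_def] using hy
  rw [Matrix.trace_eq_sum_roots_charpoly, h, Polynomial.roots_multiset_prod_X_sub_C]

/-- **Newton's identities** for a multiset, solved for the elementary symmetric function. -/
theorem Multiset.mul_esymm_eq_sum {R : Type*} [CommRing R] (s : Multiset R) (k : ℕ) :
    k * s.esymm k = (-1) ^ (k + 1) *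
      ∑ j ∈ Finset.range k, (-1) ^ j * s.esymm j * (s.map (· ^ (k - j))).sum := by
  obtain ⟨l, rfl⟩ := Quot.exists_rep s
  have hl : Finset.univ.val.map l.get = (l : Multiset R) := by
    rw [Fin.univ_val_map, List.ofFn_get]
  have h := congrArg (MvPolynomial.aeval l.get) (MvPolynomial.mul_esymm_eq_sum (Fin l.length) R k)
  have hp (m : ℕ) : MvPolynomial.aeval l.get (MvPolynomial.psum (Fin l.length) R m) =
      ((l : Multiset R).map (· ^ m)).sum := by
    rw [← hl, Multiset.map_map]
    simp only [MvPolynomial.psum, map_sum, map_pow, MvPolynomial.aeval_X]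
    rfl
  simp only [map_mul, map_natCast, map_pow, map_neg, map_one, map_sum, hp,
    MvPolynomial.aeval_esymm_eq_multiset_esymm, hl] at h
  refine h.trans ?_
  rw [Finset.sum_filter, Finset.Nat.sum_antidiagonal_eq_sum_range_succ
    (fun i j ↦ if i < k then (-1) ^ i * (l : Multiset R).esymm i *
      ((l : Multiset R).map (· ^ j)).sum else 0), Finset.sum_range_succ]
  simp only [lt_irrefl, if_false, add_zero]
  congr 1
  refine Finset.sum_congr rfl fun j hj ↦ ?_
  rw [if_pos (Finset.mem_range.mp hj)]
  rfl

theorem flM_succ_eq_sum {n : ℕ} (A : Matrix (Fin n) (Fin n) ℂ) (k : ℕ) :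
    flM A (k + 1) = A ^ (k + 1) - ∑ j ∈ Finset.Icc 1 k, flC A j • A ^ (k + 1 - j) := by
  induction k with
  | zero => simp [flM]
  | succ k ih =>
    have h : flM A (k + 2) = A * (flM A (k + 1) - flC A (k + 1) • 1) := rfl
    rw [h, ih, Finset.sum_Icc_succ_top (by omega), mul_sub, mul_sub, ← pow_succ', Finset.mul_sum,
      sub_sub]
    congr 2
    · refine Finset.sum_congr rfl fun j hj ↦ ?_
      rw [mul_smul_comm, ← pow_succ', ← Nat.sub_add_comm (by grind)]
    · simp

/-- The Faddeev–LeVerrier coefficients are the signed elementary symmetric functions of the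
eigenvalues. -/
theorem flC_eq_esymm_roots {n : ℕ} (A : Matrix (Fin n) (Fin n) ℂ) (k : ℕ) (hk : 1 ≤ k) :
    flC A k = -((-1) ^ k * A.charpoly.roots.esymm k) := by
  induction k using Nat.strong_induction_on with
  | _ k ih =>
    obtain ⟨k, rfl⟩ := Nat.exists_eq_add_of_le' hk
    have hnewton := A.charpoly.roots.mul_esymm_eq_sum (k + 1)
    have htrace : (flM A (k + 1)).trace = ∑ j ∈ Finset.range (k + 1),
        (-1) ^ j * A.charpoly.roots.esymm j *
          (A.charpoly.roots.map (· ^ (k + 1 - j))).sum := by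
      rw [flM_succ_eq_sum, Matrix.trace_sub, Matrix.trace_sum, Finset.range_eq_Ico,
        Finset.sum_eq_sum_Ico_succ_bot (by omega), sub_eq_add_neg, ← Finset.sum_neg_distrib]
      congr 1
      · simp [Multiset.esymm, Matrix.trace_pow_eq_sum_roots_charpoly]
      · refine Finset.sum_congr rfl fun j hj ↦ ?_
        rw [Finset.mem_Ico] at hj
        rw [Matrix.trace_smul, ih j (by omega) hj.1, Matrix.trace_pow_eq_sum_roots_charpoly,
          smul_eq_mul, neg_mul, neg_neg]
    have hk0 : ((k + 1 : ℕ) : ℂ) ≠ 0 := Nat.cast_ne_zero.mpr k.succ_ne_zero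
    have hsign : ((-1 : ℂ) ^ (k + 1)) * (-1) ^ (k + 1) = 1 := by
      rw [← mul_pow]; simp
    rw [← htrace, pow_succ (-1 : ℂ) (k + 1)] at hnewton
    rw [flC, div_eq_iff hk0]
    linear_combination (-1 : ℂ) ^ (k + 1) * hnewton - (flM A (k + 1)).trace * hsign

theorem charpoly_eq_faddeev_leVerrier (n : ℕ) (hn : 1 ≤ n)
    (A : Matrix (Fin n) (Fin n) ℂ) :
    A.charpoly
      = X ^ n - ∑ k ∈ Finset.Icc 1 n, Polynomial.C (flC A k) * X ^ (n - k) := by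
  have hsplits := IsAlgClosed.splits A.charpoly
  have hcard : A.charpoly.roots.card = n := by
    rw [← hsplits.natDegree_eq_card_roots, A.charpoly_natDegree_eq_dim, Fintype.card_fin]
  have h := A.charpoly.roots.prod_X_sub_X_eq_sum_esymm
  rw [← hsplits.eq_prod_roots_of_monic A.charpoly_monic, hcard, Finset.range_eq_Ico,
    Finset.sum_eq_sum_Ico_succ_bot (by omega)] at h
  rw [h, sub_eq_add_neg, ← Finset.sum_neg_distrib]
  congr 1
  · simp [Multiset.esymm]
  · refine Finset.sum_congr rfl fun k hk ↦ ?_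
    rw [flC_eq_esymm_roots A k (Finset.mem_Icc.mp hk).1]
    simp [mul_assoc]
end

section
/- For every A ∈ Mat(n,ℂ) with n ≥ 2, the Faddeev–LeVerrier sequence satisfies M_n = c_n·I_n, det(A) = (−1)^{n+1}·c_n, and the adjugate of A is given by adjugate(A) = (−1)^n·(c_{n−1}·I_n − M_{n−1}). -/
open Matrix

open Polynomial in
theorem Matrix.derivative_det {ι R : Type*} [Fintype ι] [DecidableEq ι] [CommRing R]
    (M : Matrix ι ι R[X]) :
    derivative M.det = ∑ i, (M.updateCol i fun j => derivative (M j i)).det := by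
  simp only [det_apply', derivative_sum]
  rw [Finset.sum_comm]
  refine Finset.sum_congr rfl fun σ _ => ?_
  rw [derivative_mul, derivative_intCast, zero_mul, zero_add, derivative_prod_finset, Finset.mul_sum]
  refine Finset.sum_congr rfl fun i _ => ?_
  rw [← Finset.prod_erase_mul _ _ (Finset.mem_univ i), updateCol_self]
  congr 2
  refine Finset.prod_congr rfl fun j hj => ?_
  rw [updateCol_ne (Finset.ne_of_mem_erase hj)]

open Polynomial in
theorem Matrix.trace_adjugate_charmatrix {ι R : Type*} [Fintype ι] [DecidableEq ι] [CommRing R]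
    (A : Matrix ι ι R) :
    (adjugate (charmatrix A)).trace = derivative A.charpoly := by
  rw [charpoly, derivative_det, trace]
  refine Finset.sum_congr rfl fun i _ => ?_
  rw [diag_apply, ← transpose_apply (adjugate _), adjugate_transpose, adjugate_apply,
    ← det_transpose, updateRow_transpose, transpose_transpose]
  congr 2
  ext j : 1
  obtain rfl | h := eq_or_ne j i
  · simp
  · simp [h]

/-- The matrix coefficients of the adjugate of `X - A`. -/
noncomputable def Matrix.adjCharCoeff {ι R : Type*} [Fintype ι] [DecidableEq ι] [CommRing R]
    (A : Matrix ι ι R) (k : ℕ) : Matrix ι ι R :=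
  (matPolyEquiv (adjugate (charmatrix A))).coeff k

section

open Polynomial

variable {ι R : Type*} [Fintype ι] [DecidableEq ι] [CommRing R] (A : Matrix ι ι R)

theorem Matrix.X_sub_C_mul_matPolyEquiv_adjugate :
    (X - C A) * matPolyEquiv (adjugate (charmatrix A)) =
      A.charpoly.map (algebraMap R (Matrix ι ι R)) := by
  rw [← matPolyEquiv_charmatrix, ← map_mul, mul_adjugate, ← charpoly, matPolyEquiv_smul_one]

theorem Matrix.mul_adjCharCoeff_zero :
    A * A.adjCharCoeff 0 = -(A.charpoly.coeff 0 • (1 : Matrix ι ι R)) := by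
  have h := congrArg (coeff · 0) A.X_sub_C_mul_matPolyEquiv_adjugate
  simp only [sub_mul, coeff_sub, coeff_X_mul_zero, coeff_C_mul, zero_sub, coeff_map,
    Algebra.algebraMap_eq_smul_one] at h
  rw [← h, neg_neg, adjCharCoeff]

theorem Matrix.adjCharCoeff_eq_mul_add (k : ℕ) :
    A.adjCharCoeff k =
      A * A.adjCharCoeff (k + 1) + A.charpoly.coeff (k + 1) • (1 : Matrix ι ι R) := by
  have h := congrArg (coeff · (k + 1)) A.X_sub_C_mul_matPolyEquiv_adjugate
  simp only [sub_mul, coeff_sub, coeff_X_mul, coeff_C_mul, coeff_map,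
    Algebra.algebraMap_eq_smul_one] at h
  rw [← h, adjCharCoeff, adjCharCoeff, add_sub_cancel]

theorem Matrix.adjCharCoeff_card [Nontrivial R] : A.adjCharCoeff (Fintype.card ι) = 0 := by
  rcases eq_or_ne (matPolyEquiv (adjugate (charmatrix A))) 0 with h0 | h0
  · rw [adjCharCoeff, h0, coeff_zero]
  · have := Polynomial.nontrivial_iff.mp ⟨_, _, h0⟩
    have h := congrArg natDegree A.X_sub_C_mul_matPolyEquiv_adjugate
    rw [(monic_X_sub_C A).natDegree_mul' h0, natDegree_X_sub_C,
      (A.charpoly_monic).natDegree_map, charpoly_natDegree_eq_dim] at h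
    exact coeff_eq_zero_of_natDegree_lt (by lia)

theorem Matrix.trace_adjCharCoeff (k : ℕ) :
    (A.adjCharCoeff k).trace = A.charpoly.coeff (k + 1) * (k + 1) := by
  rw [← coeff_derivative, ← trace_adjugate_charmatrix, trace, trace, finsetSum_coeff]
  simp [adjCharCoeff, matPolyEquiv_coeff_apply]

theorem Matrix.adjCharCoeff_zero : A.adjCharCoeff 0 = adjugate (-A) := by
  have h : (charmatrix A).map (evalRingHom 0) = -A := by
    ext i j
    by_cases hij : i = j <;> simp [hij]
  have h' := (evalRingHom (0 : R)).map_adjugate (charmatrix A)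
  rw [RingHom.mapMatrix_apply, RingHom.mapMatrix_apply, h] at h'
  rw [← h']
  ext i j
  simp [adjCharCoeff, matPolyEquiv_coeff_apply, coeff_zero_eq_eval_zero]

end

theorem flM_succ {n : ℕ} (A : Matrix (Fin n) (Fin n) ℂ) (k : ℕ) :
    flM A (k + 1) = A * (flM A k - flC A k • 1) := rfl

theorem flC_eq_neg_charpoly_coeff {n : ℕ} (A : Matrix (Fin n) (Fin n) ℂ) {k j : ℕ}
    (hjk : j + k + 1 = n) (h : flM A (k + 1) = A * A.adjCharCoeff j) :
    flC A (k + 1) = -A.charpoly.coeff j := by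
  have hn : (n : ℂ) = j + k + 1 := by exact_mod_cast hjk.symm
  have hk : (k : ℂ) + 1 ≠ 0 := by exact_mod_cast k.succ_ne_zero
  rw [flC, h]
  push_cast
  rw [div_eq_iff hk]
  cases j with
  | zero =>
    rw [mul_adjCharCoeff_zero, trace_neg, trace_smul, trace_one, Fintype.card_fin, hn,
      smul_eq_mul]
    push_cast
    ring
  | succ j =>
    have ht := congrArg trace (A.adjCharCoeff_eq_mul_add j)
    rw [trace_adjCharCoeff, trace_add, trace_smul, trace_one, Fintype.card_fin, hn,
      smul_eq_mul] at ht
    push_cast at ht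
    linear_combination -ht

theorem flM_sub_flC_smul_one {n : ℕ} (A : Matrix (Fin n) (Fin n) ℂ) {k j : ℕ}
    (hjk : j + k + 1 = n) : flM A k - flC A k • 1 = A.adjCharCoeff j := by
  induction k generalizing j with
  | zero =>
    have hj : j + 1 = Fintype.card (Fin n) := by rw [Fintype.card_fin, ← hjk]
    have h1 : A.charpoly.coeff (j + 1) = 1 := by
      rw [hj, ← A.charpoly_natDegree_eq_dim, A.charpoly_monic.coeff_natDegree]
    have h0 : A.adjCharCoeff (j + 1) = 0 := by rw [hj, adjCharCoeff_card]
    rw [adjCharCoeff_eq_mul_add, h0, h1]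
    simp [flM, flC]
  | succ k ih =>
    have h : flM A (k + 1) = A * A.adjCharCoeff (j + 1) := by
      rw [flM_succ, ih (j := j + 1) (by lia)]
    rw [flC_eq_neg_charpoly_coeff A (by lia) h, h, adjCharCoeff_eq_mul_add A j, neg_smul,
      sub_neg_eq_add]

theorem faddeev_leVerrier_det_adjugate (n : ℕ) (hn : 2 ≤ n)
    (A : Matrix (Fin n) (Fin n) ℂ) :
    flM A n = flC A n • (1 : Matrix (Fin n) (Fin n) ℂ) ∧
    A.det = (-1 : ℂ) ^ (n + 1) * flC A n ∧
    A.adjugate = (-1 : ℂ) ^ n • (flC A (n - 1) • (1 : Matrix (Fin n) (Fin n) ℂ) - flM A (n - 1)) := by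
  obtain ⟨m, rfl⟩ : ∃ m, n = m + 1 := ⟨n - 1, by lia⟩
  have hB : flM A m - flC A m • 1 = A.adjCharCoeff 0 := flM_sub_flC_smul_one A (by lia)
  have hM : flM A (m + 1) = A * A.adjCharCoeff 0 := by rw [flM_succ, hB]
  have hC := flC_eq_neg_charpoly_coeff A (by lia) hM
  refine ⟨?_, ?_, ?_⟩
  · rw [hC, hM, mul_adjCharCoeff_zero, neg_smul]
  · rw [hC, det_eq_sign_charpoly_coeff, Fintype.card_fin]
    ring
  · have hA : A.adjugate = (-1 : ℂ) ^ m • A.adjCharCoeff 0 := by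
      rw [adjCharCoeff_zero, ← neg_one_smul ℂ A, adjugate_smul, smul_smul, Fintype.card_fin,
        Nat.add_sub_cancel, ← mul_pow]
      simp
    rw [Nat.add_sub_cancel, hA, ← hB, pow_succ, mul_neg_one, neg_smul, ← smul_neg, neg_sub]
end

section
/- For every A ∈ Mat(n,ℂ) with n ≥ 2 and det(A) ≠ 0, the matrix A is invertible and A^{−1} = ((−1)^n / det(A))·(c_{n−1}·I_n − M_{n−1}), where c_{n−1} and M_{n−1} come from the Faddeev–LeVerrier recursion. -/
open Matrix

open Polynomial

/-- Jacobi's formula for the determinant of a matrix of polynomials. -/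
lemma derivative_det_eq_sum_updateCol {ι R : Type*} [Fintype ι] [DecidableEq ι] [CommRing R]
    (N : Matrix ι ι R[X]) :
    derivative N.det = ∑ j, (N.updateCol j fun i => derivative (N i j)).det := by
  simp_rw [det_apply', derivative_sum]
  rw [Finset.sum_comm]
  refine Finset.sum_congr rfl fun σ _ => ?_
  rw [derivative_mul, derivative_intCast, zero_mul, zero_add, derivative_prod_finset,
    Finset.mul_sum]
  refine Finset.sum_congr rfl fun j _ => ?_
  rw [← Finset.prod_erase_mul _ _ (Finset.mem_univ j), updateCol_self]
  congr 2
  refine Finset.prod_congr rfl fun i hi => ?_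
  rw [updateCol_ne (Finset.ne_of_mem_erase hi)]

lemma derivative_charpoly_eq_trace_adjugate {ι R : Type*} [Fintype ι] [DecidableEq ι] [CommRing R]
    (A : Matrix ι ι R) : derivative A.charpoly = (charmatrix A).adjugate.trace := by
  rw [charpoly, derivative_det_eq_sum_updateCol, ← trace_transpose, adjugate_transpose, trace]
  refine Finset.sum_congr rfl fun j _ => ?_
  rw [diag_apply, adjugate_apply, updateRow_transpose, det_transpose]
  congr 2
  ext1 i
  by_cases h : i = j
  · subst h; simp
  · simp [charmatrix_apply_ne _ _ _ h, Pi.single_eq_of_ne h]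

section adjugate

variable {ι R : Type*} [Fintype ι] [DecidableEq ι] [CommRing R] (A : Matrix ι ι R)

/-- The adjugate of `X - A`, as a polynomial with matrix coefficients. -/
noncomputable def adjugatePoly : (Matrix ι ι R)[X] :=
  matPolyEquiv (charmatrix A).adjugate

lemma X_sub_C_mul_adjugatePoly :
    (X - C A) * adjugatePoly A = A.charpoly.map (algebraMap R (Matrix ι ι R)) := by
  rw [adjugatePoly, ← matPolyEquiv_charmatrix, ← map_mul, mul_adjugate, ← matPolyEquiv_smul_one,
    charpoly]

lemma adjugatePoly_coeff (j : ℕ) :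
    (adjugatePoly A).coeff j =
      A * (adjugatePoly A).coeff (j + 1) + A.charpoly.coeff (j + 1) • 1 := by
  have h := congrArg (coeff · (j + 1)) (X_sub_C_mul_adjugatePoly A)
  simp only [sub_mul, coeff_sub, coeff_X_mul, coeff_C_mul, coeff_map,
    Algebra.algebraMap_eq_smul_one] at h
  rw [← h]
  abel

lemma mul_adjugatePoly_coeff_zero :
    A * (adjugatePoly A).coeff 0 = -(A.charpoly.coeff 0 • 1) := by
  have h := congrArg (coeff · 0) (X_sub_C_mul_adjugatePoly A)
  simp only [sub_mul, coeff_sub, coeff_X_mul_zero, coeff_C_mul, coeff_map,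
    Algebra.algebraMap_eq_smul_one] at h
  rw [← h]
  abel

lemma trace_adjugatePoly_coeff (j : ℕ) :
    ((adjugatePoly A).coeff j).trace = A.charpoly.coeff (j + 1) * (j + 1) := by
  rw [← coeff_derivative, derivative_charpoly_eq_trace_adjugate, trace, trace, finsetSum_coeff]
  simp [adjugatePoly, matPolyEquiv_coeff_apply]

lemma adjugatePoly_coeff_eq_zero {j : ℕ} (hj : Fintype.card ι ≤ j) :
    (adjugatePoly A).coeff j = 0 := by
  nontriviality R
  cases isEmpty_or_nonempty ι
  · exact Subsingleton.elim _ _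
  by_cases h0 : adjugatePoly A = 0
  · simp [h0]
  apply coeff_eq_zero_of_natDegree_lt
  have h := congrArg natDegree (X_sub_C_mul_adjugatePoly A)
  rw [(monic_X_sub_C A).natDegree_mul' h0, natDegree_X_sub_C] at h
  have := A.charpoly.natDegree_map_le (f := algebraMap R (Matrix ι ι R))
  rw [charpoly_natDegree_eq_dim] at this
  omega

lemma adjugatePoly_coeff_card_sub_one {j : ℕ} (hj : j + 1 = Fintype.card ι) :
    (adjugatePoly A).coeff j = 1 := by
  nontriviality R
  have h : A.charpoly.coeff (j + 1) = 1 := by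
    rw [hj, ← charpoly_natDegree_eq_dim A]
    exact A.charpoly_monic.coeff_natDegree
  rw [adjugatePoly_coeff, adjugatePoly_coeff_eq_zero A hj.ge, h]
  simp

end adjugate

lemma flM_sub_flC_eq_adjugatePoly_coeff {n : ℕ} (A : Matrix (Fin n) (Fin n) ℂ) (k j : ℕ)
    (h : k + j + 1 = n) : flM A k - flC A k • 1 = (adjugatePoly A).coeff j := by
  induction k generalizing j with
  | zero =>
    rw [adjugatePoly_coeff_card_sub_one A (by simpa using h)]
    simp [flM, flC]
  | succ k ih =>
    have hM : flM A (k + 1) = A * (adjugatePoly A).coeff (j + 1) := by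
      rw [← ih (j + 1) (by omega)]
      rfl
    have hA := adjugatePoly_coeff A j
    rw [← hM] at hA
    have ht := trace_adjugatePoly_coeff A j
    rw [hA, trace_add, trace_smul, trace_one, Fintype.card_fin, smul_eq_mul] at ht
    have hn : (n : ℂ) = k + 1 + j + 1 := by rw [← h]; push_cast; ring
    have hc : flC A (k + 1) = -A.charpoly.coeff (j + 1) := by
      rw [flC, div_eq_iff (Nat.cast_ne_zero.mpr k.succ_ne_zero)]
      push_cast
      linear_combination ht - A.charpoly.coeff (j + 1) * hn
    rw [hA, hc, neg_smul, sub_neg_eq_add]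

theorem faddeev_leVerrier_inverse (n : ℕ) (hn : 2 ≤ n)
    (A : Matrix (Fin n) (Fin n) ℂ) (hA : A.det ≠ 0) :
    IsUnit A ∧
    A⁻¹ = ((-1 : ℂ) ^ n / A.det) •
      (flC A (n - 1) • (1 : Matrix (Fin n) (Fin n) ℂ) - flM A (n - 1)) := by
  refine ⟨(isUnit_iff_isUnit_det A).mpr hA.isUnit, inv_eq_right_inv ?_⟩
  have h := flM_sub_flC_eq_adjugatePoly_coeff A (n - 1) 0 (by omega)
  have hdet := det_eq_sign_charpoly_coeff A
  rw [Fintype.card_fin] at hdet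
  rw [← neg_sub, h, mul_smul_comm, mul_neg, mul_adjugatePoly_coeff_zero, neg_neg, smul_smul,
    div_mul_eq_mul_div, ← hdet, div_self hA, one_smul]
end

section
/- For every family of coefficients u : {0,1,2}×{0,1,2} → ℂ, the determinant of U := Σ_{j,k=0}^{2} u_{jk}·β₁^j·β₂^k equals Σ_{j,k=0}^{2} u_{jk}³ − 3(u₀₀u₀₁u₀₂ + u₁₀u₁₁u₁₂ + u₂₀u₂₁u₂₂ + u₀₀u₁₀u₂₀ + u₀₁u₁₁u₂₁ + u₀₂u₁₂u₂₂) − 3ω(u₀₁u₁₂u₂₀ + u₀₂u₁₀u₂₁ + u₀₀u₁₁u₂₂) − 3ω²(u₀₂u₁₁u₂₀ + u₀₀u₁₂u₂₁ + u₀₁u₁₀u₂₂). -/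
open Matrix

noncomputable def ω : ℂ := Complex.exp (2 * Real.pi * Complex.I / 3)

noncomputable def β₁ : Matrix (Fin 3) (Fin 3) ℂ := !![0, 1, 0; 0, 0, 1; 1, 0, 0]

noncomputable def β₂ : Matrix (Fin 3) (Fin 3) ℂ := !![1, 0, 0; 0, ω, 0; 0, 0, ω ^ 2]

theorem omega_pow_three : ω ^ 3 = 1 := by
  rw [ω, ← Complex.exp_nat_mul, ← Complex.exp_two_pi_mul_I]
  congr 1
  push_cast
  ring

theorem omega_ne_one : ω ≠ 1 :=
  (Complex.isPrimitiveRoot_exp 3 (by norm_num)).ne_one (by norm_num)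

theorem one_add_omega_add_omega_sq : 1 + ω + ω ^ 2 = 0 :=
  mul_left_cancel₀ (sub_ne_zero.mpr omega_ne_one) (by linear_combination omega_pow_three)

theorem det_in_ternaryClifford (u : Fin 3 → Fin 3 → ℂ) :
    Matrix.det (∑ j : Fin 3, ∑ k : Fin 3, u j k • (β₁ ^ (j : ℕ) * β₂ ^ (k : ℕ)))
      = (∑ j : Fin 3, ∑ k : Fin 3, (u j k) ^ 3)
        - 3 * (u 0 0 * u 0 1 * u 0 2 + u 1 0 * u 1 1 * u 1 2 + u 2 0 * u 2 1 * u 2 2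
              + u 0 0 * u 1 0 * u 2 0 + u 0 1 * u 1 1 * u 2 1 + u 0 2 * u 1 2 * u 2 2)
        - 3 * ω * (u 0 1 * u 1 2 * u 2 0 + u 0 2 * u 1 0 * u 2 1 + u 0 0 * u 1 1 * u 2 2)
        - 3 * ω ^ 2 * (u 0 2 * u 1 1 * u 2 0 + u 0 0 * u 1 2 * u 2 1 + u 0 1 * u 1 0 * u 2 2) := by
  have h := one_add_omega_add_omega_sq
  simp [β₁, β₂, Fin.sum_univ_three, Matrix.det_fin_three, pow_two]
  generalize ω = w at *
  grind
end

section
/- Each of the matrices τ₁,…,τ₈ is skew-Hermitian (τ_jᴴ = −τ_j) and traceless (tr(τ_j) = 0); the eight matrices τ₁,…,τ₈ are linearly independent over ℝ, and their real linear span equals the set {A ∈ Mat(3,ℂ) : Aᴴ = −A and tr(A) = 0}, i.e., they form a basis of the real Lie algebra su(3). -/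
open Matrix

noncomputable def τ : Fin 8 → Matrix (Fin 3) (Fin 3) ℂ :=
  ![β₁ - β₁ ^ 2,
    Complex.I • (β₁ + β₁ ^ 2),
    β₂ - β₂ ^ 2,
    Complex.I • (β₂ + β₂ ^ 2),
    β₁ * β₂ - ω ^ 2 • (β₁ ^ 2 * β₂ ^ 2),
    Complex.I • (β₁ * β₂ + ω ^ 2 • (β₁ ^ 2 * β₂ ^ 2)),
    β₁ ^ 2 * β₂ - ω • (β₁ * β₂ ^ 2),
    Complex.I • (β₁ ^ 2 * β₂ + ω • (β₁ * β₂ ^ 2))]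

theorem isPrimitiveRoot_ω : IsPrimitiveRoot ω 3 := by
  simpa [ω] using Complex.isPrimitiveRoot_exp 3 (by norm_num)

theorem ω_sq : ω ^ 2 = -1 - ω := by
  have hsum := isPrimitiveRoot_ω.geom_sum_eq_zero (by norm_num)
  simp only [Finset.sum_range_succ, Finset.sum_range_zero] at hsum
  linear_combination hsum

theorem star_ω : star ω = -1 - ω := by
  have h := isPrimitiveRoot_ω
  have hconj : star ω = ω⁻¹ :=
    (Complex.inv_eq_conj (h.norm'_eq_one (by norm_num))).symm
  rw [hconj, ← ω_sq]
  exact inv_eq_of_mul_eq_one_right (by rw [← pow_succ', h.pow_eq_one])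

theorem β₁_sq : β₁ ^ 2 = !![0, 0, 1; 1, 0, 0; 0, 1, 0] := by
  simp [β₁, pow_two]

theorem β₂_sq : β₂ ^ 2 = !![1, 0, 0; 0, -1 - ω, 0; 0, 0, ω] := by
  have h := ω_sq
  simp [β₂, pow_two]
  grind

/-- The matrices `τ j` written out entrywise, with powers of `ω` reduced by `ω ^ 2 = -1 - ω`. -/
theorem τ_eq : τ =
    ![!![0, 1, -1; -1, 0, 1; 1, -1, 0],
      !![0, Complex.I, Complex.I; Complex.I, 0, Complex.I; Complex.I, Complex.I, 0],
      !![0, 0, 0; 0, 1 + 2 * ω, 0; 0, 0, -1 - 2 * ω],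
      !![2 * Complex.I, 0, 0; 0, -Complex.I, 0; 0, 0, -Complex.I],
      !![0, ω, -1; 1 + ω, 0, -1 - ω; 1, -ω, 0],
      !![0, Complex.I * ω, Complex.I; Complex.I * (-1 - ω), 0, Complex.I * (-1 - ω);
        Complex.I, Complex.I * ω, 0],
      !![0, -1, -1 - ω; 1, 0, 1 + ω; -ω, ω, 0],
      !![0, Complex.I, Complex.I * (-1 - ω); Complex.I, 0, Complex.I * (-1 - ω);
        Complex.I * ω, Complex.I * ω, 0]] := by
  have h := ω_sq
  simp only [τ, β₁_sq, β₂_sq]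
  simp [β₁, β₂]
  split_ands <;> first | (ext i; fin_cases i <;> rfl) | grind

theorem τ_conjTranspose (j : Fin 8) : (τ j)ᴴ = -τ j := by
  have h := star_ω
  rw [τ_eq]
  fin_cases j <;> ext a b <;> fin_cases a <;> fin_cases b <;>
    simp [Matrix.conjTranspose_apply] at h ⊢ <;> grind

theorem trace_τ (j : Fin 8) : (τ j).trace = 0 := by
  rw [τ_eq]
  fin_cases j <;> simp [Matrix.trace_fin_three] <;> ring

theorem trace_τ_mul_τ (j k : Fin 8) : (τ j * τ k).trace = if j = k then -6 else 0 := by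
  have h := ω_sq
  have hI := Complex.I_sq
  rw [τ_eq]
  fin_cases j <;> fin_cases k <;>
    simp [Matrix.trace_fin_three] <;> grind

theorem sum_trace_τ_mul_smul_τ (A : Matrix (Fin 3) (Fin 3) ℂ) :
    ∑ j, (τ j * A).trace • τ j = (2 * A.trace) • 1 - (6 : ℂ) • A := by
  have h := ω_sq
  have hI := Complex.I_sq
  rw [τ_eq]
  ext a b
  fin_cases a <;> fin_cases b <;>
    simp [Matrix.trace_fin_three, Matrix.mul_apply, Fin.sum_univ_eight, Fin.sum_univ_three] <;>
    grind

theorem linearIndependent_τ : LinearIndependent ℝ τ := by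
  rw [Fintype.linearIndependent_iff]
  intro g hg j
  have h : (τ j * ∑ k, g k • τ k).trace = -6 * g j := by
    simp [Finset.mul_sum, Matrix.trace_sum, trace_τ_mul_τ, mul_comm]
  simpa [hg] using h

theorem ofReal_re_trace_mul {n : Type*} [Fintype n] {A B : Matrix n n ℂ}
    (hA : Aᴴ = -A) (hB : Bᴴ = -B) : (((A * B).trace.re : ℝ) : ℂ) = (A * B).trace := by
  rw [← Complex.conj_eq_iff_re, starRingEnd_apply, ← Matrix.trace_conjTranspose,
    Matrix.conjTranspose_mul, hA, hB, neg_mul_neg, Matrix.trace_mul_comm]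

theorem mem_span_τ_iff {A : Matrix (Fin 3) (Fin 3) ℂ} :
    A ∈ Submodule.span ℝ (Set.range τ) ↔ Aᴴ = -A ∧ A.trace = 0 := by
  constructor
  · intro hA
    induction hA using Submodule.span_induction with
    | mem x hx =>
      obtain ⟨j, rfl⟩ := hx
      exact ⟨τ_conjTranspose j, trace_τ j⟩
    | zero => simp
    | add x y _ _ hx hy => simp [hx, hy, add_comm]
    | smul r x _ hx => simp [Matrix.conjTranspose_smul, hx]
  · rintro ⟨hA, htr⟩
    have hsum : ∑ j, (τ j * A).trace.re • τ j = (-6 : ℝ) • A := by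
      calc ∑ j, (τ j * A).trace.re • τ j
          = ∑ j, (τ j * A).trace • τ j := Finset.sum_congr rfl fun j _ => by
            rw [← Complex.coe_smul, ofReal_re_trace_mul (τ_conjTranspose j) hA]
        _ = (-6 : ℝ) • A := by
            rw [sum_trace_τ_mul_smul_τ, htr]
            ext a b
            simp
    rw [← Submodule.smul_mem_iff _ (show (-6 : ℝ) ≠ 0 by norm_num), ← hsum]
    exact Submodule.sum_mem _ fun j _ =>
      Submodule.smul_mem _ _ (Submodule.subset_span (Set.mem_range_self j))

theorem tau_basis_of_su3 :
    (∀ j : Fin 8, (τ j)ᴴ = -(τ j)) ∧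
    (∀ j : Fin 8, Matrix.trace (τ j) = 0) ∧
    LinearIndependent ℝ τ ∧
    (Submodule.span ℝ (Set.range τ) : Set (Matrix (Fin 3) (Fin 3) ℂ))
      = {A : Matrix (Fin 3) (Fin 3) ℂ | Aᴴ = -A ∧ Matrix.trace A = 0} := by
  exact ⟨τ_conjTranspose, trace_τ, linearIndependent_τ, Set.ext fun _ => mem_span_τ_iff⟩
end
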